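/- Let R be a commutative ring and I a proper ideal of R such that both R and R⋈I are quasi-Frobenius. Then I = Ra for some idempotent element a of R. -/

import Mathlib

/-- The amalgamated duplication of a commutative ring `R` along an ideal `I`,
realized as the subring `{(x, y) ∈ R × R : y - x ∈ I}` of `R × R`. -/
def amalgDup (R : Type*) [CommRing R] (I : Ideal R) : Subring (R × R) where
  carrier := {p | p.2 - p.1 ∈ I}
  zero_mem' := by simp
  one_mem' := by simp
  add_mem' := by
    intro a b ha hb
    have := I.add_mem ha hb
    simpa [add_sub_add_comm] using this
  neg_mem' := by
    intro a ha
    show -a.2 - -a.1 ∈ I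
    have h : -a.2 - -a.1 = -(a.2 - a.1) := by ring
    rw [h]; exact I.neg_mem ha
  mul_mem' := by
    intro a b ha hb
    have : a.2 * b.2 - a.1 * b.1 = (a.2 - a.1) * b.2 + a.1 * (b.2 - b.1) := by ring
    show a.2 * b.2 - a.1 * b.1 ∈ I
    rw [this]
    exact I.add_mem (I.mul_mem_right _ ha) (I.mul_mem_left _ hb)

/-- A commutative ring is quasi-Frobenius if it is Noetherian and self-injective. -/
def IsQuasiFrobenius (R : Type*) [CommRing R] : Prop :=
  IsNoetherianRing R ∧ Module.Injective R R

/-- The ideal `I × I` of the amalgamated duplication of `R` along `I`. -/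
def amalgDupProdIdeal {R : Type*} [CommRing R] (I : Ideal R) : Ideal (amalgDup R I) where
  carrier := {p | p.1.1 ∈ I ∧ p.1.2 ∈ I}
  zero_mem' := ⟨I.zero_mem, I.zero_mem⟩
  add_mem' ha hb := ⟨I.add_mem ha.1 hb.1, I.add_mem ha.2 hb.2⟩
  smul_mem' c _ hx := ⟨I.mul_mem_left c.1.1 hx.1, I.mul_mem_left c.1.2 hx.2⟩

/-- The projection `(i, j) ↦ (i, 0)` of the ideal `I × I` of the amalgamated duplication. -/
def amalgDupProj {R : Type*} [CommRing R] (I : Ideal R) :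
    amalgDupProdIdeal I →ₗ[amalgDup R I] amalgDup R I where
  toFun p := ⟨(p.1.1.1, 0), by
    show 0 - p.1.1.1 ∈ I
    rw [zero_sub]
    exact I.neg_mem p.2.1⟩
  map_add' _ _ := Subtype.ext (Prod.ext rfl (add_zero 0).symm)
  map_smul' c _ := Subtype.ext (Prod.ext rfl (mul_zero c.1.2).symm)

/-- If the amalgamated duplication along `I` is self-injective, then `I` contains an element
acting on `I` as the identity. -/
theorem exists_mem_mul_eq_self_of_injective {R : Type*} [CommRing R] (I : Ideal R)
    (h : Module.Injective (amalgDup R I) (amalgDup R I)) :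
    ∃ a ∈ I, ∀ x ∈ I, x * a = x := by
  obtain ⟨g, hg⟩ := Module.Baer.of_injective h (amalgDupProdIdeal I) (amalgDupProj I)
  have hmul (p : amalgDup R I) : g p = p * g 1 := by
    rw [← smul_eq_mul, ← map_smul, smul_eq_mul, mul_one]
  have key (x : R) (hx : x ∈ I) : x * (g 1).1.1 = x ∧ x * (g 1).1.2 = 0 := by
    have hp : (x, x) ∈ amalgDup R I := by
      show x - x ∈ I
      simp
    have e := congrArg Subtype.val ((hmul ⟨(x, x), hp⟩).symm.trans (hg ⟨(x, x), hp⟩ ⟨hx, hx⟩))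
    exact ⟨congrArg Prod.fst e, congrArg Prod.snd e⟩
  refine ⟨(g 1).1.1 - (g 1).1.2, ?_, fun x hx => ?_⟩
  · rw [← neg_sub]
    exact I.neg_mem (g 1).2
  · rw [mul_sub, (key x hx).1, (key x hx).2, sub_zero]

theorem exists_idempotent_of_isQuasiFrobenius (R : Type*) [CommRing R]
    (I : Ideal R) (hI : I ≠ ⊤) (hR : IsQuasiFrobenius R)
    (hdup : IsQuasiFrobenius (amalgDup R I)) :
    ∃ a : R, a * a = a ∧ I = Ideal.span {a} := by
  obtain ⟨a, ha, haI⟩ := exists_mem_mul_eq_self_of_injective I hdup.2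
  refine ⟨a, haI a ha, le_antisymm (fun x hx => ?_) ?_⟩
  · exact Ideal.mem_span_singleton'.2 ⟨x, haI x hx⟩
  · exact (Ideal.span_singleton_le_iff_mem I).2 ha
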